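/- arXiv:1109.3238 — 2 statements merged into one kernel-verified Lean document; each statement's English description precedes it below -/
import Mathlib

section
/- Let Δ ⊂ ℝ⁴ be the convex hull of the following 15 integral points: the eight points (ε₁, ε₂, ε₃, −1) with each εᵢ ∈ {+1, −1}, together with the seven points −(ε₁, ε₂, ε₃, (ε₁+ε₂+ε₃−1)/2) with each εᵢ ∈ {+1, −1} and not all εᵢ equal to +1. Then Δ is a reflexive lattice polytope: 0 lies in the interior of Δ, and its polar dual Δ* = {y ∈ ℝ⁴ | ⟨x,y⟩ ≥ −1 for all x ∈ Δ} is the convex hull of finitely many points of ℤ⁴. -/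
open RealInnerProductSpace

/-- The vertices `±e₁, ±e₂, ±e₃, e₄, (1, 1, 1, -2)` of the polar dual of the polytope. -/
def dualVertex : Fin 8 → EuclideanSpace ℝ (Fin 4) :=
  ![!₂[1, 0, 0, 0], !₂[-1, 0, 0, 0], !₂[0, 1, 0, 0], !₂[0, -1, 0, 0],
    !₂[0, 0, 1, 0], !₂[0, 0, -1, 0], !₂[0, 0, 0, 1], !₂[1, 1, 1, -2]]

theorem real_inner_fin_four (x y : EuclideanSpace ℝ (Fin 4)) :
    ⟪x, y⟫ = x 0 * y 0 + x 1 * y 1 + x 2 * y 2 + x 3 * y 3 := by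
  simp [PiLp.inner_apply, Fin.sum_univ_four, mul_comm]

theorem exists_int_dualVertex (j : Fin 8) (i : Fin 4) : ∃ m : ℤ, dualVertex j i = (m : ℝ) := by
  fin_cases j <;> fin_cases i <;>
    first
      | (refine ⟨0, ?_⟩; simp [dualVertex]; done)
      | (refine ⟨1, ?_⟩; simp [dualVertex]; done)
      | (refine ⟨-1, ?_⟩; simp [dualVertex]; done)
      | (refine ⟨-2, ?_⟩; simp [dualVertex])

/-- A point `t • (1, 1, 1, -2) + s • e₄ + (p, q, r, 0)` with `s, t ≥ 0` and
`|p| + |q| + |r| + s + t ≤ 1` lies in the convex hull of the `dualVertex`s. -/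
theorem mem_convexHull_dualVertex (y : EuclideanSpace ℝ (Fin 4)) {s t : ℝ} (hs : 0 ≤ s)
    (ht : 0 ≤ t) (hd : y 3 = s - 2 * t)
    (h : |y 0 - t| + |y 1 - t| + |y 2 - t| + s + t ≤ 1) :
    y ∈ convexHull ℝ (Set.range dualVertex) := by
  obtain ⟨p, hp⟩ : ∃ p, p = y 0 - t := ⟨_, rfl⟩
  obtain ⟨q, hq⟩ : ∃ q, q = y 1 - t := ⟨_, rfl⟩
  obtain ⟨r, hr⟩ : ∃ r, r = y 2 - t := ⟨_, rfl⟩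
  rw [← hp, ← hq, ← hr] at h
  have hp₁ := neg_abs_le p
  have hp₂ := le_abs_self p
  have hq₁ := neg_abs_le q
  have hq₂ := le_abs_self q
  have hr₁ := neg_abs_le r
  have hr₂ := le_abs_self r
  let w : Fin 8 → ℝ :=
    ![(1 - |q| - |r| - s - t + p) / 2, (1 - |q| - |r| - s - t - p) / 2,
      (|q| + q) / 2, (|q| - q) / 2, (|r| + r) / 2, (|r| - r) / 2, s, t]
  have hy : y = ∑ j, w j • dualVertex j := by
    ext i
    fin_cases i <;> simp [w, dualVertex, Fin.sum_univ_eight] <;> linarith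
  rw [hy]
  refine (convex_convexHull ℝ _).sum_mem (fun j _ ↦ ?_) ?_
    fun j _ ↦ subset_convexHull ℝ _ (Set.mem_range_self j)
  · fin_cases j <;> simp [w] <;> linarith
  · simp [w, Fin.sum_univ_eight]
    ring

/-- Five vertices of the polytope span a simplex containing a neighbourhood of `0`. -/
theorem zero_mem_interior_convexHull {S : Set (EuclideanSpace ℝ (Fin 4))}
    (h₀ : !₂[1, 1, 1, 2] ∈ S) (h₁ : !₂[1, 1, 1, -1] ∈ S) (h₂ : !₂[-1, -1, 1, 0] ∈ S)
    (h₃ : !₂[-1, 1, -1, 0] ∈ S) (h₄ : !₂[1, -1, -1, 0] ∈ S) :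
    (0 : EuclideanSpace ℝ (Fin 4)) ∈ interior (convexHull ℝ S) := by
  let v : Fin 5 → EuclideanSpace ℝ (Fin 4) :=
    ![!₂[1, 1, 1, 2], !₂[1, 1, 1, -1], !₂[-1, -1, 1, 0], !₂[-1, 1, -1, 0], !₂[1, -1, -1, 0]]
  let w : EuclideanSpace ℝ (Fin 4) → Fin 5 → ℝ := fun x ↦
    ![(1 + x 0 + x 1 + x 2 + 4 * x 3) / 12, (1 + x 0 + x 1 + x 2 - 2 * x 3) / 6,
      (1 - x 0 - x 1 + x 2) / 4, (1 - x 0 + x 1 - x 2) / 4, (1 + x 0 - x 1 - x 2) / 4]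
  have hw : Continuous w := by
    refine continuous_pi fun j ↦ ?_
    fin_cases j <;> simp [w] <;> fun_prop
  refine mem_interior.2 ⟨⋂ j, {x | 0 < w x j}, fun x hx ↦ ?_,
    isOpen_iInter_of_finite fun j ↦ isOpen_lt continuous_const ((continuous_apply j).comp hw), ?_⟩
  · have hxw : x = ∑ j, w x j • v j := by
      ext i
      fin_cases i <;> simp [w, v, Fin.sum_univ_five] <;> ring
    rw [hxw]
    refine (convex_convexHull ℝ _).sum_mem (fun j _ ↦ (Set.mem_iInter.1 hx j).le) ?_
      fun j _ ↦ subset_convexHull ℝ _ ?_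
    · simp [w, Fin.sum_univ_five]
      ring
    · fin_cases j <;> simpa [v]
  · refine Set.mem_iInter.2 fun j ↦ ?_
    fin_cases j <;> simp [w]

/-- The convex hull `Δ ⊂ ℝ⁴` of the eight points `(ε₁, ε₂, ε₃, -1)` with `εᵢ = ±1` together
with the seven points `-(ε₁, ε₂, ε₃, (ε₁+ε₂+ε₃-1)/2)` with `εᵢ = ±1`, not all `+1`, is a
reflexive lattice polytope: `0` lies in its interior and its polar dual is the convex hull
of finitely many integral points. -/
theorem example_polytope_is_reflexive
    (V : Set (EuclideanSpace ℝ (Fin 4)))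
    (hV : V = {v : EuclideanSpace ℝ (Fin 4) |
        (∃ ε : Fin 3 → ℝ, (∀ i, ε i = 1 ∨ ε i = -1) ∧
          v 0 = ε 0 ∧ v 1 = ε 1 ∧ v 2 = ε 2 ∧ v 3 = -1) ∨
        (∃ ε : Fin 3 → ℝ, (∀ i, ε i = 1 ∨ ε i = -1) ∧ (¬ ∀ i, ε i = 1) ∧
          v 0 = -ε 0 ∧ v 1 = -ε 1 ∧ v 2 = -ε 2 ∧
          v 3 = -((ε 0 + ε 1 + ε 2 - 1) / 2))})
    (Δ : Set (EuclideanSpace ℝ (Fin 4)))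
    (hΔ : Δ = convexHull ℝ V) :
    (0 : EuclideanSpace ℝ (Fin 4)) ∈ interior Δ ∧
      ∃ T : Finset (EuclideanSpace ℝ (Fin 4)),
        (∀ v ∈ T, ∀ i, ∃ m : ℤ, v i = (m : ℝ)) ∧
        {y : EuclideanSpace ℝ (Fin 4) | ∀ x ∈ Δ, -1 ≤ ⟪x, y⟫}
          = convexHull ℝ (T : Set (EuclideanSpace ℝ (Fin 4))) := by
  have mem₁ (a b c : ℝ) (ha : a = 1 ∨ a = -1) (hb : b = 1 ∨ b = -1) (hc : c = 1 ∨ c = -1) :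
      !₂[a, b, c, -1] ∈ V := by
    rw [hV]
    exact Or.inl ⟨![a, b, c], by simp [Fin.forall_fin_succ, ha, hb, hc], by simp⟩
  have mem₂ (a b c d : ℝ) (ha : a = 1 ∨ a = -1) (hb : b = 1 ∨ b = -1) (hc : c = 1 ∨ c = -1)
      (hd : d = (a + b + c + 1) / 2) (h : ¬ (a = -1 ∧ b = -1 ∧ c = -1)) :
      !₂[a, b, c, d] ∈ V := by
    rw [hV]
    refine Or.inr ⟨![-a, -b, -c], ?_, ?_, by simp, by simp, by simp, ?_⟩
    · simp [Fin.forall_fin_succ, neg_eq_iff_eq_neg, ha.symm, hb.symm, hc.symm]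
    · simpa [Fin.forall_fin_succ, neg_eq_iff_eq_neg] using h
    · simp [hd]
      ring
  subst hΔ
  refine ⟨zero_mem_interior_convexHull ?_ ?_ ?_ ?_ ?_,
    (Set.finite_range dualVertex).toFinset, ?_, ?_⟩
  · apply mem₂ <;> norm_num
  · apply mem₁ <;> norm_num
  · apply mem₂ <;> norm_num
  · apply mem₂ <;> norm_num
  · apply mem₂ <;> norm_num
  · simpa using exists_int_dualVertex
  rw [Set.Finite.coe_toFinset]
  apply Set.Subset.antisymm
  · intro y hy
    have ineq (a b c d : ℝ) (h : !₂[a, b, c, d] ∈ V) :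
        -1 ≤ a * y 0 + b * y 1 + c * y 2 + d * y 3 := by
      simpa [real_inner_fin_four] using hy _ (subset_convexHull ℝ V h)
    have i₁ (a b c : ℝ) (ha : a = 1 ∨ a = -1) (hb : b = 1 ∨ b = -1) (hc : c = 1 ∨ c = -1) :=
      ineq a b c (-1) (mem₁ a b c ha hb hc)
    have i₂ (a b c : ℝ) (ha : a = 1 ∨ a = -1) (hb : b = 1 ∨ b = -1) (hc : c = 1 ∨ c = -1)
        (h : ¬ (a = -1 ∧ b = -1 ∧ c = -1)) :=
      ineq a b c ((a + b + c + 1) / 2) (mem₂ a b c _ ha hb hc rfl h)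
    have hmmm := i₁ (-1) (-1) (-1) (by simp) (by simp) (by simp)
    rcases le_total 0 (y 3) with h | h
    · refine mem_convexHull_dualVertex y h le_rfl (by ring) ?_
      have hppp := i₁ 1 1 1 (by simp) (by simp) (by simp)
      have hppm := i₁ 1 1 (-1) (by simp) (by simp) (by simp)
      have hpmp := i₁ 1 (-1) 1 (by simp) (by simp) (by simp)
      have hpmm := i₁ 1 (-1) (-1) (by simp) (by simp) (by simp)
      have hmpp := i₁ (-1) 1 1 (by simp) (by simp) (by simp)
      have hmpm := i₁ (-1) 1 (-1) (by simp) (by simp) (by simp)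
      have hmmp := i₁ (-1) (-1) 1 (by simp) (by simp) (by simp)
      rcases abs_cases (y 0 - 0) with ⟨h0, -⟩ | ⟨h0, -⟩ <;>
      rcases abs_cases (y 1 - 0) with ⟨h1, -⟩ | ⟨h1, -⟩ <;>
      rcases abs_cases (y 2 - 0) with ⟨h2, -⟩ | ⟨h2, -⟩ <;>
      rw [h0, h1, h2] <;> linarith
    · refine mem_convexHull_dualVertex y (s := 0) (t := -y 3 / 2) le_rfl (by linarith)
        (by ring) ?_
      have hppp := i₂ 1 1 1 (by simp) (by simp) (by simp) (by norm_num)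
      have hppm := i₂ 1 1 (-1) (by simp) (by simp) (by simp) (by norm_num)
      have hpmp := i₂ 1 (-1) 1 (by simp) (by simp) (by simp) (by norm_num)
      have hpmm := i₂ 1 (-1) (-1) (by simp) (by simp) (by simp) (by norm_num)
      have hmpp := i₂ (-1) 1 1 (by simp) (by simp) (by simp) (by norm_num)
      have hmpm := i₂ (-1) 1 (-1) (by simp) (by simp) (by simp) (by norm_num)
      have hmmp := i₂ (-1) (-1) 1 (by simp) (by simp) (by simp) (by norm_num)
      rcases abs_cases (y 0 - -y 3 / 2) with ⟨h0, -⟩ | ⟨h0, -⟩ <;>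
      rcases abs_cases (y 1 - -y 3 / 2) with ⟨h1, -⟩ | ⟨h1, -⟩ <;>
      rcases abs_cases (y 2 - -y 3 / 2) with ⟨h2, -⟩ | ⟨h2, -⟩ <;>
      rw [h0, h1, h2] <;> linarith
  · refine fun y hy x hx ↦ convexHull_min (t := {y | -1 ≤ ⟪x, y⟫}) ?_
      (convex_halfSpace_ge (innerₗ _ x).isLinear (-1)) hy
    rintro _ ⟨j, rfl⟩
    refine convexHull_min (t := {x | -1 ≤ ⟪x, dualVertex j⟫}) ?_
      (convex_halfSpace_ge ((innerₗ _).flip (dualVertex j)).isLinear (-1)) hx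
    intro v hv
    rw [hV] at hv
    rw [Set.mem_ofPred_eq, real_inner_fin_four]
    rcases hv with ⟨ε, hε, h0, h1, h2, h3⟩ | ⟨ε, hε, hne, h0, h1, h2, h3⟩
    · rw [h0, h1, h2, h3]
      rcases hε 0 with e0 | e0 <;> rcases hε 1 with e1 | e1 <;> rcases hε 2 with e2 | e2 <;>
        fin_cases j <;> simp [dualVertex, e0, e1, e2] <;> norm_num
    · rw [h0, h1, h2, h3]
      rcases hε 0 with e0 | e0 <;> rcases hε 1 with e1 | e1 <;> rcases hε 2 with e2 | e2
      · simp [Fin.forall_fin_succ, e0, e1, e2] at hne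
      all_goals fin_cases j <;> simp [dualVertex, e0, e1, e2] <;> norm_num
end

section
/- Let C ⊆ ℝⁿ be a closed convex cone, let f : ℝⁿ → ℝ be a linear functional with f(x) > 0 for every nonzero x ∈ C, and suppose C contains a nonzero point of ℤⁿ. Let G be a group of linear automorphisms of ℝⁿ such that every g ∈ G maps ℤⁿ onto ℤⁿ, maps C onto C, and satisfies f ∘ g = f. Then there exists a nonzero vector w ∈ C with g(w) = w for all g ∈ G. -/
/-- A linear functional that is strictly positive on the nonzero points of a closed cone
dominates a positive multiple of the norm there. -/
theorem exists_pos_mul_norm_le_of_pos_on_cone {E : Type*} [NormedAddCommGroup E]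
    [NormedSpace ℝ E] [FiniteDimensional ℝ E] {C : Set E} (hC : IsClosed C)
    (hcone : ∀ x ∈ C, ∀ t : ℝ, 0 ≤ t → t • x ∈ C) (f : E →ₗ[ℝ] ℝ)
    (hf : ∀ x ∈ C, x ≠ 0 → 0 < f x) :
    ∃ c : ℝ, 0 < c ∧ ∀ x ∈ C, c * ‖x‖ ≤ f x := by
  have : ProperSpace E := FiniteDimensional.proper ℝ E
  have hK : IsCompact (Metric.sphere (0 : E) 1 ∩ C) := (isCompact_sphere 0 1).inter_right hC
  have hpos : ∀ x ∈ Metric.sphere (0 : E) 1 ∩ C, 0 < f x := fun x hx ↦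
    hf x hx.2 (ne_zero_of_mem_unit_sphere ⟨x, hx.1⟩)
  obtain ⟨c, hc, hle⟩ :=
    hK.exists_forall_le' f.continuous_of_finiteDimensional.continuousOn hpos
  refine ⟨c, hc, fun x hx ↦ ?_⟩
  rcases eq_or_ne x 0 with rfl | hx0
  · simp
  have hn : 0 < ‖x‖ := norm_pos_iff.2 hx0
  have hmem : ‖x‖⁻¹ • x ∈ Metric.sphere (0 : E) 1 ∩ C :=
    ⟨by simp [norm_smul, hn.ne'], hcone x hx _ (inv_nonneg.2 hn.le)⟩
  have h := hle _ hmem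
  rwa [map_smul, smul_eq_mul, inv_mul_eq_div, le_div_iff₀ hn] at h

/-- A ball contains only finitely many integral points. -/
theorem EuclideanSpace.finite_integral_points_norm_le {ι : Type*} [Fintype ι] (R : ℝ) :
    {x : EuclideanSpace ℝ ι | (∀ i, ∃ m : ℤ, x i = (m : ℝ)) ∧ ‖x‖ ≤ R}.Finite := by
  classical
  refine ((Set.finite_Icc (fun _ : ι ↦ -⌈R⌉) (fun _ ↦ ⌈R⌉)).image
    fun m ↦ WithLp.toLp 2 fun i ↦ (m i : ℝ)).subset ?_
  rintro x ⟨hx, hR⟩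
  choose m hm using hx
  have hbound : ∀ i, |m i| ≤ ⌈R⌉ := fun i ↦ by
    have h := (PiLp.norm_apply_le x i).trans (hR.trans (Int.le_ceil R))
    rw [hm, Real.norm_eq_abs] at h
    exact_mod_cast h
  exact ⟨m, ⟨fun i ↦ (abs_le.1 (hbound i)).1, fun i ↦ (abs_le.1 (hbound i)).2⟩,
    by ext i; simp [hm]⟩


/-- Wilson's invariant-class construction: if `C ⊆ ℝⁿ` is a closed convex cone, `f` a
linear functional strictly positive on the nonzero points of `C`, and `C` contains a
nonzero integral point, then for any group `G` of linear automorphisms of `ℝⁿ` preserving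
the lattice `ℤⁿ`, the cone `C` and the functional `f`, there is a nonzero `G`-fixed
vector `w ∈ C`. -/
theorem exists_invariant_vector_in_cone
    (n : ℕ) (C : Set (EuclideanSpace ℝ (Fin n)))
    (hCclosed : IsClosed C) (hCconvex : Convex ℝ C)
    (hcone : ∀ x ∈ C, ∀ t : ℝ, 0 ≤ t → t • x ∈ C)
    (f : EuclideanSpace ℝ (Fin n) →ₗ[ℝ] ℝ)
    (hf : ∀ x ∈ C, x ≠ 0 → 0 < f x)
    (L : Set (EuclideanSpace ℝ (Fin n)))
    (hL : L = {x : EuclideanSpace ℝ (Fin n) | ∀ i, ∃ m : ℤ, x i = (m : ℝ)})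
    (hint : ∃ x ∈ C ∩ L, x ≠ 0)
    (G : Subgroup (EuclideanSpace ℝ (Fin n) ≃ₗ[ℝ] EuclideanSpace ℝ (Fin n)))
    (hGlattice : ∀ g ∈ G, (g : EuclideanSpace ℝ (Fin n) ≃ₗ[ℝ] EuclideanSpace ℝ (Fin n)) '' L = L)
    (hGcone : ∀ g ∈ G, (g : EuclideanSpace ℝ (Fin n) ≃ₗ[ℝ] EuclideanSpace ℝ (Fin n)) '' C = C)
    (hGf : ∀ g ∈ G, ∀ x, f ((g : EuclideanSpace ℝ (Fin n) ≃ₗ[ℝ] EuclideanSpace ℝ (Fin n)) x) = f x) :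
    ∃ w ∈ C, w ≠ 0 ∧ ∀ g ∈ G,
      (g : EuclideanSpace ℝ (Fin n) ≃ₗ[ℝ] EuclideanSpace ℝ (Fin n)) w = w := by
  obtain ⟨x₀, ⟨hx₀C, hx₀L⟩, hx₀⟩ := hint
  obtain ⟨c, hc, hle⟩ := exists_pos_mul_norm_le_of_pos_on_cone hCclosed hcone f hf
  have hfin : {x | x ∈ C ∧ x ∈ L ∧ f x = f x₀}.Finite := by
    refine (EuclideanSpace.finite_integral_points_norm_le (f x₀ / c)).subset ?_
    rintro x ⟨hxC, hxL, hfx⟩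
    rw [hL] at hxL
    exact ⟨hxL, (le_div_iff₀' hc).2 (hfx ▸ hle x hxC)⟩
  have hmem : ∀ x, x ∈ hfin.toFinset ↔ x ∈ C ∧ x ∈ L ∧ f x = f x₀ := fun x ↦ hfin.mem_toFinset
  have hadd : ∀ x y, x ∈ C → y ∈ C → x + y ∈ C := fun x y hx hy ↦ by
    have h := hcone _ (hCconvex.midpoint_mem hx hy) 2 zero_le_two
    rwa [two_smul, midpoint_add_self] at h
  refine ⟨∑ x ∈ hfin.toFinset, x, ?_, fun h0 ↦ ?_, fun g hg ↦ ?_⟩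
  · exact Finset.sum_induction _ (· ∈ C) hadd (by simpa using hcone x₀ hx₀C 0 le_rfl)
      fun x hx ↦ ((hmem x).1 hx).1
  · have hpos : 0 < ∑ x ∈ hfin.toFinset, f x :=
      Finset.sum_pos (fun x hx ↦ ((hmem x).1 hx).2.2 ▸ hf x₀ hx₀C hx₀)
        ⟨x₀, (hmem x₀).2 ⟨hx₀C, hx₀L, rfl⟩⟩
    rw [← map_sum, h0, map_zero] at hpos
    exact hpos.false
  · have hmaps : Set.MapsTo g hfin.toFinset hfin.toFinset := fun x hx ↦ by
      obtain ⟨hxC, hxL, hfx⟩ := (hmem x).1 hx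
      exact (hmem _).2 ⟨hGcone g hg ▸ Set.mem_image_of_mem g hxC,
        hGlattice g hg ▸ Set.mem_image_of_mem g hxL, (hGf g hg x).trans hfx⟩
    rw [map_sum]
    exact Finset.sum_nbij g hmaps g.injective.injOn
      (Finset.surjOn_of_injOn_of_card_le g hmaps g.injective.injOn le_rfl) fun _ _ ↦ rfl
end
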